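/- arXiv:1508.03691 — 2 statements merged into one kernel-verified Lean document; each statement's English description precedes it below -/
import Mathlib

section
/- Let C be a finite category possessing both a weighting w and a coweighting, and possessing an initial object or a terminal object. Then ∑_{a ∈ ob C} w(a) = 1; that is, the Euler characteristic of C equals 1. -/
open CategoryTheory

/-- The total of a weighting equals the total of a coweighting. -/
theorem sum_weighting_eq_sum_coweighting {ι R : Type*} [Fintype ι] [CommSemiring R]
    (Z : ι → ι → R) (w v : ι → R) (hw : ∀ a, ∑ b, Z a b * w b = 1)
    (hv : ∀ b, ∑ a, v a * Z a b = 1) : ∑ a, w a = ∑ a, v a := by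
  calc ∑ b, w b = ∑ b, (∑ a, v a * Z a b) * w b := by simp [hv]
    _ = ∑ a, v a * ∑ b, Z a b * w b := by
      simp_rw [Finset.sum_mul, Finset.mul_sum, mul_assoc]
      exact Finset.sum_comm
    _ = ∑ a, v a := by simp [hw]

/-- A finite category with a weighting, a coweighting, and an
initial or terminal object has Euler characteristic `1`. -/
theorem eulerChar_eq_one_of_initial_or_terminal
    (C : Type*) [Category C] [Fintype C] [∀ a b : C, Fintype (a ⟶ b)]
    (w v : C → ℚ)
    (hw : ∀ a : C, ∑ b : C, (Fintype.card (a ⟶ b) : ℚ) * w b = 1)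
    (hv : ∀ b : C, ∑ a : C, v a * (Fintype.card (a ⟶ b) : ℚ) = 1)
    (hobj : (∃ x : C, ∀ y : C, Fintype.card (x ⟶ y) = 1) ∨
            (∃ x : C, ∀ y : C, Fintype.card (y ⟶ x) = 1)) :
    ∑ a : C, w a = 1 := by
  obtain ⟨x, hx⟩ | ⟨x, hx⟩ := hobj
  · simpa [hx] using hw x
  · rw [sum_weighting_eq_sum_coweighting (fun a b : C => (Fintype.card (a ⟶ b) : ℚ)) w v hw hv]
    simpa [hx] using hv x
end

section
/- Let C be a finite category in which every full subcategory admits both a weighting and a coweighting (so every set S of objects has an Euler characteristic χ(S)), let Q be a finite poset, and let F : ob C → Q be measurable (the preimage of every upper set of Q is a filter of C and the preimage of every lower set of Q is an ideal of C). Let B be a filter of C and let A be a lower set of Q. Let I_A be a ℚ-linear map from functions Q → ℚ to ℚ such that I_A(1_T) = χ_Q(T) for every subset T ⊆ A that is an upper set of the subposet A. Define g : Q → ℚ by g(d) = χ(F⁻¹({q ∈ Q | q ≤ d}) ∩ B). Then I_A(g·1_A) = χ(F⁻¹(A) ∩ B); that is, the Euler integration over A of the pushforward of the incidence function of B equals the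 Euler characteristic of F⁻¹(A) ∩ B. -/
open CategoryTheory
open scoped Classical

/-- A filter of a category: closed under targets of morphisms out of its members. -/
def CatFilter (C : Type*) [Category C] (S : Set C) : Prop :=
  ∀ x ∈ S, ∀ y : C, Nonempty (x ⟶ y) → y ∈ S

/-- An ideal of a category: closed under sources of morphisms into its members. -/
def CatIdeal (C : Type*) [Category C] (S : Set C) : Prop :=
  ∀ x ∈ S, ∀ y : C, Nonempty (y ⟶ x) → y ∈ S

/-- A weighting on a set `S` of objects of `C`. -/
def IsWeightingOn (C : Type*) [Category C] [Fintype C] [∀ a b : C, Fintype (a ⟶ b)]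
    (S : Set C) (w : C → ℚ) : Prop :=
  ∀ a ∈ S, (∑ b : C, if b ∈ S then (Fintype.card (a ⟶ b) : ℚ) * w b else 0) = 1

/-- A coweighting on a set `S` of objects of `C`. -/
def IsCoweightingOn (C : Type*) [Category C] [Fintype C] [∀ a b : C, Fintype (a ⟶ b)]
    (S : Set C) (v : C → ℚ) : Prop :=
  ∀ b ∈ S, (∑ a : C, if a ∈ S then v a * (Fintype.card (a ⟶ b) : ℚ) else 0) = 1

/-- The weighting of a subset `S` of a finite poset: vanishes outside `S` and
satisfies `∑_{b ∈ S, a ≤ b} w b = 1` for every `a ∈ S`. -/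
def IsPosetWeighting (Q : Type*) [PartialOrder Q] [Fintype Q]
    (S : Set Q) (w : Q → ℚ) : Prop :=
  (∀ x : Q, x ∉ S → w x = 0) ∧
  ∀ a ∈ S, (∑ b : Q, if b ∈ S ∧ a ≤ b then w b else 0) = 1

/-- `T` is an upper set of the subposet on `A`. -/
def UpperIn (Q : Type*) [PartialOrder Q] (A T : Set Q) : Prop :=
  T ⊆ A ∧ ∀ x ∈ T, ∀ y ∈ A, x ≤ y → y ∈ T

/-- The total weight of a weighting on `T` is the total of any coweighting on a larger set `S`
over `T`, provided `T` is closed in `S` under sources of morphisms. -/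
theorem IsWeightingOn.sum_eq_sum_coweighting {C : Type*} [Category C] [Fintype C]
    [∀ a b : C, Fintype (a ⟶ b)] {S T : Set C} {w v : C → ℚ} (hw : IsWeightingOn C T w)
    (hv : IsCoweightingOn C S v) (hTS : T ⊆ S)
    (hT : ∀ b ∈ T, ∀ a ∈ S, Nonempty (a ⟶ b) → a ∈ T) :
    (∑ b : C, if b ∈ T then w b else 0) = ∑ a : C, if a ∈ T then v a else 0 := by
  have hb : ∀ b : C, (if b ∈ T then w b else 0) =
      ∑ a : C, if a ∈ T ∧ b ∈ T then v a * (Fintype.card (a ⟶ b) : ℚ) * w b else 0 := by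
    intro b
    by_cases hbT : b ∈ T
    · rw [if_pos hbT]
      conv_lhs => rw [← one_mul (w b), ← hv b (hTS hbT), Finset.sum_mul]
      refine Finset.sum_congr rfl fun a _ => ?_
      by_cases haT : a ∈ T
      · simp [haT, hTS haT, hbT]
      · by_cases haS : a ∈ S
        · have : IsEmpty (a ⟶ b) := not_nonempty_iff.mp fun h => haT (hT b hbT a haS h)
          simp [haT]
        · simp [haT, haS]
    · simp [hbT]
  have ha : ∀ a : C, (if a ∈ T then v a else 0) =
      ∑ b : C, if a ∈ T ∧ b ∈ T then v a * (Fintype.card (a ⟶ b) : ℚ) * w b else 0 := by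
    intro a
    by_cases haT : a ∈ T
    · rw [if_pos haT]
      conv_lhs => rw [← mul_one (v a), ← hw a haT, Finset.mul_sum]
      refine Finset.sum_congr rfl fun b _ => ?_
      by_cases hbT : b ∈ T <;> simp [haT, hbT, mul_assoc]
    · simp [haT]
  rw [Finset.sum_congr rfl fun b _ => hb b, Finset.sum_congr rfl fun a _ => ha a,
    Finset.sum_comm]

/-- The total weight of a subset of a poset with a least element is `1`. -/
theorem IsPosetWeighting.sum_eq_one {Q : Type*} [PartialOrder Q] [Fintype Q] {S : Set Q}
    {w : Q → ℚ} (hw : IsPosetWeighting Q S w) {m : Q} (hm : IsLeast S m) :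
    (∑ b : Q, if b ∈ S then w b else 0) = 1 := by
  rw [← hw.2 m hm.1]
  refine Finset.sum_congr rfl fun b _ => ?_
  by_cases hb : b ∈ S
  · simp [hb, hm.2 hb]
  · simp [hb]

/-- The Euler integration over a lower set `A` of the
pushforward of the incidence function of a filter `B` equals `χ(F⁻¹(A) ∩ B)`. -/
theorem euler_integration_pushforward_indicator
    (C : Type*) [Category C] [Fintype C] [∀ a b : C, Fintype (a ⟶ b)]
    (Q : Type*) [PartialOrder Q] [Fintype Q]
    (χ : Set C → ℚ)
    (hχ : ∀ S : Set C,
      ∃ w v : C → ℚ, IsWeightingOn C S w ∧ IsCoweightingOn C S v ∧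
        χ S = ∑ b : C, if b ∈ S then w b else 0)
    (χQ : Set Q → ℚ)
    (hχQ : ∀ S : Set Q,
      ∃ w : Q → ℚ, IsPosetWeighting Q S w ∧ χQ S = ∑ b : Q, if b ∈ S then w b else 0)
    (F : C → Q)
    (hFup : ∀ S : Set Q, IsUpperSet S → CatFilter C (F ⁻¹' S))
    (hFlow : ∀ S : Set Q, IsLowerSet S → CatIdeal C (F ⁻¹' S))
    (B : Set C) (hB : CatFilter C B)
    (A : Set Q) (hA : IsLowerSet A)
    (IA : (Q → ℚ) →ₗ[ℚ] ℚ)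
    (hIA : ∀ T : Set Q, UpperIn Q A T →
      IA (fun d => if d ∈ T then 1 else 0) = χQ T)
    (g : Q → ℚ) (hg : ∀ d : Q, g d = χ (F ⁻¹' {q : Q | q ≤ d} ∩ B)) :
    IA (fun d => if d ∈ A then g d else 0) = χ (F ⁻¹' A ∩ B) := by
  obtain ⟨w, v, hw, hv, hχS⟩ := hχ (F ⁻¹' A ∩ B)
  have hgA : ∀ d ∈ A, g d = ∑ a : C, if a ∈ F ⁻¹' {q : Q | q ≤ d} ∩ B then v a else 0 := by
    intro d hd
    obtain ⟨w', -, hw', -, hχd⟩ := hχ (F ⁻¹' {q : Q | q ≤ d} ∩ B)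
    rw [hg, hχd]
    convert hw'.sum_eq_sum_coweighting hv (fun a ha => ⟨hA ha.1 hd, ha.2⟩)
      fun b hb a ha hab => ⟨hFlow {q : Q | q ≤ d} (isLowerSet_Iic d) b hb.1 a hab, ha.2⟩
  have hI : ∀ a ∈ F ⁻¹' A ∩ B, IA (fun d => if d ∈ A ∩ Set.Ici (F a) then 1 else 0) = 1 := by
    intro a ha
    obtain ⟨u, hu, hχu⟩ := hχQ (A ∩ Set.Ici (F a))
    have hup : UpperIn Q A (A ∩ Set.Ici (F a)) :=
      ⟨Set.inter_subset_left, fun x hx y hy hxy => ⟨hy, le_trans hx.2 hxy⟩⟩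
    rw [hu.sum_eq_one ⟨⟨ha.1, le_rfl⟩, fun x hx => hx.2⟩] at hχu
    convert (hIA _ hup).trans hχu
  have hsum : (fun d => if d ∈ A then g d else 0) =
      ∑ a : C, (if a ∈ F ⁻¹' A ∩ B then v a else 0) •
        (fun d : Q => if d ∈ A ∩ Set.Ici (F a) then (1 : ℚ) else 0) := by
    ext d
    rw [Finset.sum_apply]
    by_cases hd : d ∈ A
    · rw [if_pos hd, hgA d hd]
      refine Finset.sum_congr rfl fun a _ => ?_
      by_cases had : F a ≤ d
      · simp [had, hd, hA had hd]
      · simp [had]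
    · simp [hd]
  rw [hsum, map_sum, hχS, hw.sum_eq_sum_coweighting hv subset_rfl fun _ _ _ ha _ => ha]
  refine Finset.sum_congr rfl fun a _ => ?_
  rw [map_smul]
  by_cases ha : a ∈ F ⁻¹' A ∩ B
  · rw [hI a ha, smul_eq_mul, mul_one, if_pos ha, if_pos ha]
  · rw [if_neg ha, if_neg ha, zero_smul]
end
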